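/- arXiv:2309.16892 — 3 statements merged into one kernel-verified Lean document; each statement's English description precedes it below -/
import Mathlib

section
/- Let k ≥ 9 be an integer such that k^{1/4} is a natural number. Let (G,𝒳,k) be a Yes-instance of EDP where G is a split graph, and let 𝒫 be a minimum solution of (G,𝒳,k). Then the total number of edges used by the solution satisfies Σ_{P ∈ 𝒫} |E(P)| ≤ 5·k^{3/2}. -/
open SimpleGraph Finset

/-- A family of walks in `G` connecting the terminal pairs `X`. -/
abbrev WalkFamily {V : Type*} (G : SimpleGraph V) {ι : Type*} (X : ι → V × V) :=
  ∀ i : ι, G.Walk (X i).1 (X i).2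

/-- The walks in the family are pairwise edge-disjoint. -/
def PairwiseEdgeDisjoint {V : Type*} (G : SimpleGraph V) {ι : Type*} (X : ι → V × V)
    (P : WalkFamily G X) : Prop :=
  ∀ i j : ι, i ≠ j → ∀ e : Sym2 V, e ∈ (P i).edges → e ∉ (P j).edges

/-- A solution of the Edge-Disjoint Paths (EDP) instance `(G, X)`: a family of paths
connecting the terminal pairs that are pairwise edge-disjoint. -/
def IsEDPSolution {V : Type*} (G : SimpleGraph V) {ι : Type*} (X : ι → V × V)
    (P : WalkFamily G X) : Prop :=
  (∀ i, (P i).IsPath) ∧ PairwiseEdgeDisjoint G X P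

/-- `(G, X)` is a Yes-instance of EDP. -/
def EDPYes {V : Type*} (G : SimpleGraph V) {ι : Type*} (X : ι → V × V) : Prop :=
  ∃ P : WalkFamily G X, IsEDPSolution G X P

/-- A minimum solution of the EDP instance `(G, X)`: a solution minimizing the total
number of edges of the paths. -/
def IsMinEDPSolution {V : Type*} (G : SimpleGraph V) {ι : Type*} [Fintype ι]
    (X : ι → V × V) (P : WalkFamily G X) : Prop :=
  IsEDPSolution G X P ∧
    ∀ Q : WalkFamily G X, IsEDPSolution G X Q →
      ∑ i, (P i).length ≤ ∑ i, (Q i).length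

/-- `(C, I)` is a split partition of `G`: `V(G)` is the disjoint union of `C` and `I`,
`C` induces a clique, and `I` is an independent set. -/
def IsSplitPartition {V : Type*} (G : SimpleGraph V) (C I : Finset V) : Prop :=
  (∀ x : V, x ∈ C ∨ x ∈ I) ∧ (∀ x : V, ¬ (x ∈ C ∧ x ∈ I)) ∧
  (∀ x ∈ C, ∀ y ∈ C, x ≠ y → G.Adj x y) ∧ (∀ x ∈ I, ∀ y ∈ I, ¬ G.Adj x y)

namespace SimpleGraph.Walk

variable {V : Type*} {G : SimpleGraph V}

/-- A walk splits at two of its positions into three consecutive walks. -/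
theorem exists_eq_append_append {s t : V} (p : G.Walk s t) {a b : ℕ} (hab : a ≤ b)
    (hb : b ≤ p.length) :
    ∃ (w₁ : G.Walk s (p.getVert a)) (w₂ : G.Walk (p.getVert a) (p.getVert b))
      (w₃ : G.Walk (p.getVert b) t), p = w₁.append (w₂.append w₃) ∧ w₂.length = b - a ∧
        ∀ c, a ≤ c → c ≤ b → p.getVert c ∈ w₂.support := by
  have hv : (p.drop a).getVert (b - a) = p.getVert b := by
    rw [drop_getVert, Nat.add_sub_cancel' hab]
  rw [← hv]
  refine ⟨p.take a, (p.drop a).take (b - a), (p.drop a).drop (b - a), ?_, ?_, fun c hac hcb => ?_⟩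
  · rw [append_take_drop_eq, append_take_drop_eq]
  · rw [take_length, drop_length]
    omega
  · have hc : ((p.drop a).take (b - a)).getVert (c - a) = p.getVert c := by
      rw [take_getVert, drop_getVert]
      congr 1
      omega
    rw [← hc]
    exact getVert_mem_support _ _

/-- Splitting a walk at one of its edges, traversed in one direction or the other. -/
theorem exists_edges_eq_append_cons {x y u v : V} (p : G.Walk x y) (h : s(u, v) ∈ p.edges) :
    (∃ (q : G.Walk x u) (r : G.Walk v y), p.edges = q.edges ++ s(u, v) :: r.edges ∧
      p.support = q.support ++ r.support) ∨
    (∃ (q : G.Walk x v) (r : G.Walk u y), p.edges = q.edges ++ s(u, v) :: r.edges ∧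
      p.support = q.support ++ r.support) := by
  induction p with
  | nil => simp at h
  | @cons x z y hxz p ih =>
    rw [edges_cons, List.mem_cons] at h
    rcases h with h | h
    · rcases Sym2.eq_iff.mp h with ⟨rfl, rfl⟩ | ⟨rfl, rfl⟩
      · exact Or.inl ⟨nil, p, by simp, by simp⟩
      · exact Or.inr ⟨nil, p, by simp [Sym2.eq_swap], by simp⟩
    · rcases ih h with ⟨q, r, he, hs⟩ | ⟨q, r, he, hs⟩
      · exact Or.inl ⟨cons hxz q, r, by simp [he], by simp [hs]⟩
      · exact Or.inr ⟨cons hxz q, r, by simp [he], by simp [hs]⟩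

/-- A path leaves a segment by its endpoints only. -/
theorem IsPath.notMem_support_of_append_append {x u v y m : V} {q : G.Walk x u} {w : G.Walk u v}
    {r : G.Walk v y} (h : (q.append (w.append r)).IsPath) (hm : m ∈ w.support) (hu : m ≠ u)
    (hv : m ≠ v) : m ∉ q.support ∧ m ∉ r.support := by
  refine ⟨fun hq => ?_, fun hr => ?_⟩
  · exact h.ne_of_mem_support_of_append hu hq (by simp [hm]) rfl
  · exact h.of_append_right.ne_of_mem_support_of_append hv hm hr rfl

/-- Two vertices joined by an edge of a path occupy consecutive positions. -/
theorem IsPath.eq_add_one_of_mem_edges {s t : V} {p : G.Walk s t} (hp : p.IsPath) {a b : ℕ}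
    (hab : a < b) (hb : b ≤ p.length) (h : s(p.getVert a, p.getVert b) ∈ p.edges) :
    b = a + 1 := by
  obtain ⟨n, hn, he⟩ := p.mk_mem_edges_iff_exists.mp h
  have inj : ∀ {m l : ℕ}, m ≤ p.length → l ≤ p.length → p.getVert m = p.getVert l → m = l :=
    fun hm hl he => hp.getVert_injOn hm hl he
  rcases Sym2.eq_iff.mp he with ⟨h₁, h₂⟩ | ⟨h₁, h₂⟩
  · have := inj (by omega) (by omega) h₁
    have := inj (by omega) (by omega) h₂
    omega
  · have := inj (by omega) (by omega) h₁
    have := inj (by omega) (by omega) h₂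
    omega

end SimpleGraph.Walk

section MinSolution

variable {V : Type*} {G : SimpleGraph V} {ι : Type*} [Fintype ι] {X : ι → V × V}
  {P : WalkFamily G X}

/-- A minimum solution is no longer than any edge-disjoint family of walks. -/
theorem IsMinEDPSolution.sum_length_le (hP : IsMinEDPSolution G X P) {Q : WalkFamily G X}
    (hQ : PairwiseEdgeDisjoint G X Q) : ∑ i, (P i).length ≤ ∑ i, (Q i).length := by
  classical
  refine (hP.2 (fun i => (Q i).bypass) ⟨fun i => (Q i).bypass_isPath, ?_⟩).trans
    (Finset.sum_le_sum fun i _ => (Q i).length_bypass_le_length)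
  intro i j hij e hi hj
  exact hQ i j hij e ((Q i).edges_bypass_subset_edges hi) ((Q j).edges_bypass_subset_edges hj)

/-- An edge-disjoint family of walks as short as a minimum solution consists of paths. -/
theorem IsMinEDPSolution.isPath_of_sum_length_le (hP : IsMinEDPSolution G X P)
    {Q : WalkFamily G X} (hQ : PairwiseEdgeDisjoint G X Q)
    (hle : ∑ i, (Q i).length ≤ ∑ i, (P i).length) (i : ι) : (Q i).IsPath := by
  classical
  by_contra hi
  have hlt : (Q i).bypass.length < (Q i).length := by
    by_contra! h
    exact hi ((Q i).bypass_eq_self_of_length_le_length_bypass h ▸ (Q i).bypass_isPath)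
  have hbp : PairwiseEdgeDisjoint G X fun i => (Q i).bypass := fun i j hij e h₁ h₂ =>
    hQ i j hij e ((Q i).edges_bypass_subset_edges h₁) ((Q j).edges_bypass_subset_edges h₂)
  have := hP.sum_length_le hbp
  have := Finset.sum_lt_sum (fun i _ => (Q i).length_bypass_le_length) ⟨i, mem_univ i, hlt⟩
  omega

/-- Every chord of a path of a minimum solution is used by some path of the solution. -/
theorem IsMinEDPSolution.exists_mem_edges (hP : IsMinEDPSolution G X P) (i : ι) {a b : ℕ}
    (hab : a < b) (hb : b ≤ (P i).length) (h : G.Adj ((P i).getVert a) ((P i).getVert b)) :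
    ∃ j, s((P i).getVert a, (P i).getVert b) ∈ (P j).edges := by
  classical
  by_contra! hno
  obtain ⟨w₁, w₂, w₃, hp, hlen, -⟩ := (P i).exists_eq_append_append hab.le hb
  have hedges : (P i).edges = w₁.edges ++ (w₂.edges ++ w₃.edges) := by
    conv_lhs => rw [hp]
    simp
  have hlength : (P i).length = w₁.length + (w₂.length + w₃.length) := by
    conv_lhs => rw [hp]
    simp
  have hw₂ : w₂.length ≠ 1 := fun h₁ => hno i <| by
    have hmem : s((P i).getVert a, (P i).getVert b) ∈ w₂.edges :=
      w₂.mk_mem_edges_iff_exists.mpr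
        ⟨0, by omega, by rw [zero_add, w₂.getVert_zero, w₂.getVert_of_length_le h₁.le]⟩
    rw [hedges]
    simp [hmem]
  set q := w₁.append (Walk.cons h w₃) with hq
  have hqedges : ∀ e ∈ q.edges, e = s((P i).getVert a, (P i).getVert b) ∨ e ∈ (P i).edges := by
    intro e he
    rw [hedges]
    simp only [hq, Walk.edges_append, Walk.edges_cons, List.mem_append, List.mem_cons] at he ⊢
    tauto
  have hqlength : q.length = w₁.length + (w₃.length + 1) := by simp [hq]
  have hQ : PairwiseEdgeDisjoint G X (Function.update P i q) := by
    have hd : ∀ j, j ≠ i → ∀ e ∈ q.edges, e ∉ (P j).edges := by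
      intro j hj e he hej
      rcases hqedges e he with rfl | he'
      · exact hno j hej
      · exact hP.1.2 i j hj.symm e he' hej
    intro j l hjl e hj hl
    by_cases hji : j = i
    · subst hji
      rw [Function.update_self] at hj
      rw [Function.update_of_ne hjl.symm] at hl
      exact hd l hjl.symm e hj hl
    · rw [Function.update_of_ne hji] at hj
      by_cases hli : l = i
      · subst hli
        rw [Function.update_self] at hl
        exact hd j hji e hl hj
      · rw [Function.update_of_ne hli] at hl
        exact hP.1.2 j l hjl e hj hl
  refine (hP.sum_length_le hQ).not_gt (Finset.sum_lt_sum (fun j _ => ?_) ⟨i, mem_univ i, ?_⟩)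
  · by_cases hji : j = i
    · subst hji
      rw [Function.update_self]
      omega
    · rw [Function.update_of_ne hji]
  · rw [Function.update_self]
    omega

/-- Replacing two walks of a minimum solution by two edge-disjoint walks that use the same edges
and have the same total length yields paths. -/
theorem IsMinEDPSolution.isPath_of_exchange (hP : IsMinEDPSolution G X P) {i j : ι} (hij : i ≠ j)
    {q : G.Walk (X i).1 (X i).2} {r : G.Walk (X j).1 (X j).2}
    (hq : ∀ e ∈ q.edges, e ∈ (P i).edges ∨ e ∈ (P j).edges)
    (hr : ∀ e ∈ r.edges, e ∈ (P i).edges ∨ e ∈ (P j).edges)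
    (hqr : ∀ e ∈ q.edges, e ∉ r.edges)
    (hlen : q.length + r.length = (P i).length + (P j).length) : r.IsPath := by
  classical
  let Q : WalkFamily G X := Function.update (Function.update P i q) j r
  have hQj : Q j = r := Function.update_self ..
  have hQi : Q i = q := by simp [Q, hij]
  have hQl : ∀ l, l ≠ i → l ≠ j → Q l = P l := fun l hi hj => by simp [Q, hi, hj]
  have hdisj := hP.1.2
  have hQ : PairwiseEdgeDisjoint G X Q := by
    have hd : ∀ l, l ≠ i → l ≠ j → ∀ e, e ∈ (P i).edges ∨ e ∈ (P j).edges → e ∉ (P l).edges :=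
      fun l hi hj e he hel => he.elim (fun h => hdisj i l hi.symm e h hel)
        fun h => hdisj j l hj.symm e h hel
    intro l m hlm e hl hm
    by_cases hli : l = i
    · subst hli
      rw [hQi] at hl
      by_cases hmj : m = j
      · subst hmj
        rw [hQj] at hm
        exact hqr e hl hm
      · rw [hQl m hlm.symm hmj] at hm
        exact hd m hlm.symm hmj e (hq e hl) hm
    by_cases hlj : l = j
    · subst hlj
      rw [hQj] at hl
      by_cases hmi : m = i
      · subst hmi
        rw [hQi] at hm
        exact hqr e hm hl
      · rw [hQl m hmi hlm.symm] at hm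
        exact hd m hmi hlm.symm e (hr e hl) hm
    rw [hQl l hli hlj] at hl
    by_cases hmi : m = i
    · subst hmi
      rw [hQi] at hm
      exact hd l hli hlj e (hq e hm) hl
    by_cases hmj : m = j
    · subst hmj
      rw [hQj] at hm
      exact hd l hli hlj e (hr e hm) hl
    rw [hQl m hmi hmj] at hm
    exact hdisj l m hlm e hl hm
  rw [← hQj]
  refine hP.isPath_of_sum_length_le hQ (le_of_eq ?_) j
  have hj : j ∈ univ.erase i := by simp [hij.symm]
  rw [← add_sum_erase _ _ (mem_univ i), ← add_sum_erase _ _ hj,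
    ← add_sum_erase univ (fun l => (P l).length) (mem_univ i), ← add_sum_erase _ _ hj, hQi, hQj,
    ← add_assoc, hlen, add_assoc]
  congr 2
  refine sum_congr rfl fun l hl => ?_
  simp only [mem_erase, mem_univ, and_true] at hl
  rw [hQl l hl.2 hl.1]

/-- A path of a minimum solution that uses a chord of another one avoids the interior of the
segment spanned by this chord. -/
theorem IsMinEDPSolution.getVert_notMem_support (hP : IsMinEDPSolution G X P) {i j : ι}
    (hij : i ≠ j) {a b c : ℕ} (hac : a < c) (hcb : c < b) (hb : b ≤ (P i).length)
    (h : s((P i).getVert a, (P i).getVert b) ∈ (P j).edges) :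
    (P i).getVert c ∉ (P j).support := by
  obtain ⟨w₁, w₂, w₃, hp, -, hsupp⟩ := (P i).exists_eq_append_append (hac.trans hcb).le hb
  have hedges : (P i).edges = w₁.edges ++ (w₂.edges ++ w₃.edges) := by
    conv_lhs => rw [hp]
    simp
  have hlength : (P i).length = w₁.length + (w₂.length + w₃.length) := by
    conv_lhs => rw [hp]
    simp
  have hnodup := (hP.1.1 i).isTrail.edges_nodup
  have hnodup' := (hP.1.1 j).isTrail.edges_nodup
  have hdisj := hP.1.2 i j hij
  have hadj := (P j).adj_of_mem_edges h
  have hm := hsupp c hac.le hcb.le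
  have hca : (P i).getVert c ≠ (P i).getVert a := fun he => hac.ne'
    ((hP.1.1 i).getVert_injOn (by simp; omega) (by simp; omega) he)
  have hcb' : (P i).getVert c ≠ (P i).getVert b := fun he => hcb.ne
    ((hP.1.1 i).getVert_injOn (by simp; omega) (by simp; omega) he)
  rw [hedges] at hnodup hdisj
  have key : ∀ {x y : V} (q : G.Walk (X j).1 x) (w : G.Walk x y) (r : G.Walk y (X j).2),
      (P j).edges = q.edges ++ s((P i).getVert a, (P i).getVert b) :: r.edges →
      (∀ e, e ∈ w.edges ↔ e ∈ w₂.edges) → w.length = w₂.length →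
      (q.append (w.append r)).IsPath := by
    intro x y q w r he hw hwl
    have hlength' : (P j).length = q.length + (r.length + 1) := by
      rw [← Walk.length_edges, he]
      simp
    rw [he] at hnodup' hdisj
    refine hP.isPath_of_exchange hij (q := w₁.append (Walk.cons hadj w₃)) ?_ ?_ ?_ ?_
    · rw [hedges, he]
      intro e
      simp only [Walk.edges_append, Walk.edges_cons, List.mem_append, List.mem_cons]
      tauto
    · rw [hedges, he]
      intro e
      simp only [Walk.edges_append, List.mem_append, List.mem_cons, hw]
      tauto
    · intro e h₁ h₂
      simp only [Walk.edges_append, Walk.edges_cons, List.mem_append, List.mem_cons, hw] at h₁ h₂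
      simp only [List.nodup_append', List.nodup_cons, List.disjoint_append_right,
        List.disjoint_cons_right] at hnodup hnodup'
      have hd := hdisj e
      simp only [List.mem_append, List.mem_cons] at hd
      rcases h₁ with h₁ | rfl | h₁ <;> rcases h₂ with h₂ | h₂ | h₂
      · exact hd (.inl h₁) (.inl h₂)
      · exact hnodup.2.2.1 h₁ h₂
      · exact hd (.inl h₁) (.inr (.inr h₂))
      · exact hnodup'.2.2.1 h₂
      · exact hd (.inr (.inl h₂)) (.inr (.inl rfl))
      · exact hnodup'.2.1.1 h₂
      · exact hd (.inr (.inr h₁)) (.inl h₂)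
      · exact hnodup.2.1.2.2 h₂ h₁
      · exact hd (.inr (.inr h₁)) (.inr (.inr h₂))
    · simp only [Walk.length_append, Walk.length_cons]
      omega
  rcases (P j).exists_edges_eq_append_cons h with ⟨q, r, he, hs⟩ | ⟨q, r, he, hs⟩
  · have := (key q w₂ r he (by simp) rfl).notMem_support_of_append_append hm hca hcb'
    simpa [hs] using this
  · have := (key q w₂.reverse r he (by simp) (by simp)).notMem_support_of_append_append
      (by simpa using hm) hcb' hca
    simpa [hs] using this

/-- Two chords of a path of a minimum solution that cross a common position and are used by the
same path coincide. -/
theorem IsMinEDPSolution.chord_unique (hP : IsMinEDPSolution G X P) {i j : ι} {a b a' b' : ℕ}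
    (hab : a < b) (hab' : a < b') (ha'b : a' < b) (ha'b' : a' < b') (hb : b ≤ (P i).length)
    (hb' : b' ≤ (P i).length) (h : s((P i).getVert a, (P i).getVert b) ∈ (P j).edges)
    (h' : s((P i).getVert a', (P i).getVert b') ∈ (P j).edges) : a = a' ∧ b = b' := by
  by_cases hij : i = j
  · subst hij
    have := (hP.1.1 i).eq_add_one_of_mem_edges hab hb h
    have := (hP.1.1 i).eq_add_one_of_mem_edges ha'b' hb' h'
    omega
  · have h₁ : ¬ a < a' := fun hlt => hP.getVert_notMem_support hij hlt ha'b hb h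
      ((P j).fst_mem_support_of_mem_edges h')
    have h₂ : ¬ a' < a := fun hlt => hP.getVert_notMem_support hij hlt hab' hb' h'
      ((P j).fst_mem_support_of_mem_edges h)
    have h₃ : ¬ b' < b := fun hlt => hP.getVert_notMem_support hij hab' hlt hb h
      ((P j).snd_mem_support_of_mem_edges h')
    have h₄ : ¬ b < b' := fun hlt => hP.getVert_notMem_support hij ha'b hlt hb' h'
      ((P j).snd_mem_support_of_mem_edges h)
    omega

/-- In a split graph, a path of length `l` in a minimum solution with `k` terminal pairs satisfies
`⌊(l + 1) / 4⌋ ^ 2 ≤ k`. -/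
theorem IsMinEDPSolution.sq_length_div_le_card (hP : IsMinEDPSolution G X P) {C I : Finset V}
    (hsplit : IsSplitPartition G C I) (i : ι) :
    (((P i).length + 1) / 4) ^ 2 ≤ Fintype.card ι := by
  classical
  set q := ((P i).length + 1) / 4 with hq
  have hinj := (hP.1.1 i).getVert_injOn
  have hC : ∀ t, ∃ n, 2 * t + 1 ≤ (P i).length →
      (n = 2 * t ∨ n = 2 * t + 1) ∧ (P i).getVert n ∈ C := by
    intro t
    by_cases ht : 2 * t + 1 ≤ (P i).length
    · rcases hsplit.1 ((P i).getVert (2 * t)) with h₁ | h₁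
      · exact ⟨2 * t, fun _ => ⟨Or.inl rfl, h₁⟩⟩
      · rcases hsplit.1 ((P i).getVert (2 * t + 1)) with h₂ | h₂
        · exact ⟨2 * t + 1, fun _ => ⟨Or.inr rfl, h₂⟩⟩
        · exact (hsplit.2.2.2 _ h₁ _ h₂ ((P i).adj_getVert_succ ht)).elim
    · exact ⟨0, fun h => (ht h).elim⟩
  choose f hf using hC
  have hcross : ∀ x y : Fin q, f x < f (q + y) ∧ f (q + y) ≤ (P i).length := by
    intro x y
    have := (hf x (by omega)).1
    have := (hf (q + y) (by omega)).1
    omega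
  have hused : ∀ z : Fin q × Fin q,
      ∃ j, s((P i).getVert (f z.1), (P i).getVert (f (q + z.2))) ∈ (P j).edges := by
    rintro ⟨x, y⟩
    obtain ⟨hlt, hle⟩ := hcross x y
    refine hP.exists_mem_edges i hlt hle (hsplit.2.2.1 _ (hf x (by omega)).2 _
      (hf (q + y) (by omega)).2 fun he => hlt.ne (hinj (by simp; omega) (by simp; omega) he))
  choose g hg using hused
  have hginj : Function.Injective g := by
    rintro ⟨x, y⟩ ⟨x', y'⟩ he
    have h := hg (x, y)
    rw [he] at h
    obtain ⟨h₁, h₂⟩ := hP.chord_unique (hcross x y).1 (hcross x y').1 (hcross x' y).1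
      (hcross x' y').1 (hcross x y).2 (hcross x' y').2 h (hg (x', y'))
    have := (hf x (by omega)).1
    have := (hf x' (by omega)).1
    have := (hf (q + y) (by omega)).1
    have := (hf (q + y') (by omega)).1
    rw [Prod.mk.injEq]
    exact ⟨Fin.ext (by omega), Fin.ext (by omega)⟩
  simpa [sq] using Fintype.card_le_of_injective g hginj

end MinSolution

/-- Let `k ≥ 9` with `k^(1/4)` a natural number. Then a minimum EDP solution
of a Yes-instance on a split graph with `k` terminal pairs uses at most `5 k^(3/2)` edges
in total. -/
theorem min_edp_solution_total_edges {V : Type*} [Fintype V] (G : SimpleGraph V)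
    (C I : Finset V) (hsplit : IsSplitPartition G C I)
    {k : ℕ} (hk : 9 ≤ k) (hquartic : ∃ m : ℕ, m ^ 4 = k)
    (X : Fin k → V × V) (hX : ∀ i, (X i).1 ≠ (X i).2)
    (P : WalkFamily G X) (hP : IsMinEDPSolution G X P) :
    ((∑ i, (P i).length : ℕ) : ℝ) ≤ 5 * (k : ℝ) ^ ((3 : ℝ) / 2) := by
  obtain ⟨m, rfl⟩ := hquartic
  have hm : 2 ≤ m := by
    by_contra! h
    interval_cases m <;> omega
  have hlen : ∀ i, (P i).length ≤ 5 * m ^ 2 := by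
    intro i
    have h := hP.sq_length_div_le_card hsplit i
    rw [Fintype.card_fin, show m ^ 4 = (m ^ 2) ^ 2 by ring] at h
    have h' := (Nat.pow_le_pow_iff_left two_ne_zero).mp h
    have : 2 ≤ m ^ 2 := by nlinarith
    omega
  have hsum : ∑ i, (P i).length ≤ 5 * m ^ 6 := by
    calc ∑ i, (P i).length ≤ ∑ _i : Fin (m ^ 4), 5 * m ^ 2 := sum_le_sum fun i _ => hlen i
      _ = 5 * m ^ 6 := by
        simp
        ring
  have hpow : (((m ^ 4 : ℕ) : ℝ)) ^ ((3 : ℝ) / 2) = (m : ℝ) ^ 6 := by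
    rw [Nat.cast_pow, ← Real.rpow_natCast, ← Real.rpow_natCast, ← Real.rpow_mul (by positivity)]
    norm_num
  rw [hpow]
  exact_mod_cast hsum
end

section
/- Let G be a split graph with split partition (C, I), let 𝒳 be a multiset of k terminal pairs, and let I_N ⊆ I be the set of vertices of I that appear in no terminal pair. Suppose |I_N| ≥ 4k+2 and there is an ordering v_1, v_2, …, v_{|I_N|} of I_N such that N(v_{|I_N|}) ⊆ N(v_{|I_N|−1}) ⊆ ⋯ ⊆ N(v_1). Let R = {v_{4k+2}, …, v_{|I_N|}}. Then (G,𝒳,k) is a Yes-instance of EDP if and only if (G − R, 𝒳, k) is a Yes-instance of EDP. -/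
open SimpleGraph Finset

/-- `y` is a terminal vertex: it appears in at least one terminal pair of `X`. -/
def IsTerminal {V : Type*} {ι : Type*} (X : ι → V × V) (y : V) : Prop :=
  ∃ i : ι, (X i).1 = y ∨ (X i).2 = y

/-- On a path, every vertex has at most two neighbors. -/
lemma SimpleGraph.Walk.IsPath.exists_forall_mk_mem_edges {V : Type*} {G : SimpleGraph V} {u w : V}
    {p : G.Walk u w} (hp : p.IsPath) (a : V) :
    ∃ x y : V, ∀ z, s(a, z) ∈ p.edges → z = x ∨ z = y := by
  by_cases ha : a ∈ p.support
  · obtain ⟨n, rfl, hn⟩ := Walk.mem_support_iff_exists_getVert.1 ha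
    refine ⟨p.getVert (n - 1), p.getVert (n + 1), fun z hz => ?_⟩
    obtain ⟨i, hi, hil⟩ := p.toSubgraph_adj_iff.1 (Walk.adj_toSubgraph_iff_mem_edges.2 hz)
    rcases Sym2.eq_iff.1 hi with ⟨h, rfl⟩ | ⟨rfl, h⟩
    · have : i = n := hp.getVert_injOn (by simp; omega) (by simpa using hn) h
      exact Or.inr (by rw [this])
    · have : i + 1 = n := hp.getVert_injOn (by simp; omega) (by simpa using hn) h
      exact Or.inl (by rw [← this, Nat.add_sub_cancel])
  · exact ⟨a, a, fun z hz => absurd (p.fst_mem_support_of_mem_edges hz) ha⟩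

/-- An inner vertex `y` of a path can be replaced by any common neighbor `z` of its two
neighbors on the path. -/
lemma SimpleGraph.Walk.IsPath.exists_reroute {V : Type*} {G : SimpleGraph V} {u w y : V}
    {p : G.Walk u w} (hp : p.IsPath) (hy : y ∈ p.support) (hu : u ≠ y) (hw : w ≠ y) :
    ∃ a b : V, G.Adj y a ∧ G.Adj y b ∧ ∀ z, G.Adj z a → G.Adj z b →
      ∃ q : G.Walk u w, q.IsPath ∧
        (∀ e ∈ q.edges, e ∈ p.edges ∨ e = s(a, z) ∨ e = s(b, z)) ∧
        ∀ x ∈ q.support, x = z ∨ (x ∈ p.support ∧ x ≠ y) := by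
  classical
  obtain ⟨p₁, p₂, rfl⟩ := Walk.mem_support_iff_exists_append.1 hy
  obtain ⟨a, h₁, r₁, hr₁⟩ := Walk.exists_eq_cons_of_ne hu.symm p₁.reverse
  obtain ⟨b, h₂, r₂, rfl⟩ := Walk.exists_eq_cons_of_ne hw.symm p₂
  obtain rfl : p₁ = (Walk.cons h₁ r₁).reverse := by rw [← hr₁, Walk.reverse_reverse]
  refine ⟨a, b, h₁, h₂, fun z hza hzb =>
    ⟨(r₁.reverse.append (Walk.cons hza.symm (Walk.cons hzb r₂))).bypass,
      Walk.bypass_isPath _, fun e he => ?_, fun x hx => ?_⟩⟩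
  · have := Walk.edges_bypass_subset_edges _ he
    simp only [Walk.edges_append, Walk.edges_reverse, Walk.edges_cons, List.mem_append,
      List.mem_reverse, List.mem_cons] at this ⊢
    rw [Sym2.eq_swap (a := b)]
    tauto
  · have := Walk.support_bypass_subset_support _ hx
    have hnd := hp.support_nodup
    simp only [Walk.mem_support_append_iff, Walk.support_reverse, Walk.support_cons,
      List.mem_reverse, List.mem_cons] at this ⊢
    simp only [Walk.support_append, Walk.support_reverse, Walk.support_cons, List.tail_cons,
      List.reverse_cons, List.append_assoc, List.nodup_append, List.nodup_cons, List.mem_cons,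
      List.mem_reverse, List.cons_append, List.nil_append] at hnd
    have hy₁ : y ∉ r₁.support := fun h => hnd.2.2 y h y (by simp) rfl
    have hy₂ : y ∉ r₂.support := hnd.2.1.1
    have ha := r₁.start_mem_support
    by_cases hxz : x = z
    · exact Or.inl hxz
    · refine Or.inr ⟨?_, ?_⟩
      · rcases this with h | rfl | h | h <;> tauto
      · rintro rfl
        rcases this with h | rfl | h | h <;> tauto

/-- If more than `4k` vertices `A` outside `R` dominate all the neighborhoods of the non-terminal
vertices `R`, then any solution can be turned into one avoiding `R`. -/
lemma EDPYes.exists_solution_avoiding {V : Type*} {G : SimpleGraph V} {k : ℕ}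
    {X : Fin k → V × V} {A R : Finset V} (hA : 4 * k < #A) (hdisj : Disjoint A R)
    (hR : ∀ y ∈ R, ¬ IsTerminal X y)
    (hdom : ∀ z ∈ A, ∀ y ∈ R, ∀ x, G.Adj y x → G.Adj z x) (h : EDPYes G X) :
    ∃ P : WalkFamily G X, IsEDPSolution G X P ∧ ∀ i, ∀ y ∈ (P i).support, y ∉ R := by
  classical
  obtain ⟨P, hP⟩ := h
  induction hn : ∑ i, #{x ∈ R | x ∈ (P i).support} using Nat.strong_induction_on generalizing P with
  | _ n ih =>
  by_contra! hcon
  obtain ⟨i, y, hyP, hyR⟩ := hcon P hP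
  obtain ⟨a, b, hya, hyb, hre⟩ := (hP.1 i).exists_reroute hyP
    (fun h => hR y hyR ⟨i, Or.inl h⟩) (fun h => hR y hyR ⟨i, Or.inr h⟩)
  choose a₁ a₂ ha using fun l => (hP.1 l).exists_forall_mk_mem_edges a
  choose b₁ b₂ hb using fun l => (hP.1 l).exists_forall_mk_mem_edges b
  let B : Finset V := univ.biUnion fun l => {a₁ l, a₂ l, b₁ l, b₂ l}
  have hB : #B ≤ 4 * k := by
    refine (card_biUnion_le_card_mul _ _ 4 fun l _ => card_le_four).trans ?_
    simp [mul_comm]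
  obtain ⟨z, hzA, hzB⟩ := exists_mem_notMem_of_card_lt_card (hB.trans_lt hA)
  have hfree : ∀ l, s(a, z) ∉ (P l).edges ∧ s(b, z) ∉ (P l).edges := by
    refine fun l => ⟨fun h => hzB ?_, fun h => hzB ?_⟩
    · have := ha l z h
      simp only [B, mem_biUnion, mem_univ, true_and, mem_insert, mem_singleton]
      exact ⟨l, by tauto⟩
    · have := hb l z h
      simp only [B, mem_biUnion, mem_univ, true_and, mem_insert, mem_singleton]
      exact ⟨l, by tauto⟩
  obtain ⟨q, hq, hqe, hqs⟩ := hre z (hdom z hzA y hyR a hya) (hdom z hzA y hyR b hyb)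
  have hzR : z ∉ R := disjoint_left.1 hdisj hzA
  have hqP : ∀ l, l ≠ i → ∀ e ∈ q.edges, e ∉ (P l).edges := by
    intro l hl e he
    rcases hqe e he with h | rfl | rfl
    · exact hP.2 i l hl.symm e h
    · exact (hfree l).1
    · exact (hfree l).2
  have hsol : IsEDPSolution G X (Function.update P i q) := by
    refine ⟨fun l => ?_, fun l l' hll' e => ?_⟩
    · by_cases hl : l = i
      · subst hl
        rwa [Function.update_self]
      · rw [Function.update_of_ne hl]
        exact hP.1 l
    · by_cases hl : l = i
      · subst hl
        rw [Function.update_self, Function.update_of_ne hll'.symm]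
        exact hqP l' hll'.symm e
      · by_cases hl' : l' = i
        · subst hl'
          rw [Function.update_self, Function.update_of_ne hl]
          exact fun h h' => hqP l hl e h' h
        · rw [Function.update_of_ne hl, Function.update_of_ne hl']
          exact hP.2 l l' hll' e
  have hsub : ({x ∈ R | x ∈ q.support} : Finset V) ⊆ {x ∈ R | x ∈ (P i).support} := by
    intro x hx
    rw [mem_filter] at hx ⊢
    rcases hqs x hx.2 with rfl | h
    · exact absurd hx.1 hzR
    · exact ⟨hx.1, h.1⟩
  have hlt : ∑ l, #{x ∈ R | x ∈ (Function.update P i q l).support} < n := by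
    rw [← hn]
    refine sum_lt_sum (fun l _ => ?_) ⟨i, mem_univ i, ?_⟩
    · by_cases hl : l = i
      · subst hl
        rw [Function.update_self]
        exact card_le_card hsub
      · rw [Function.update_of_ne hl]
    · rw [Function.update_self]
      refine card_lt_card ((ssubset_iff_of_subset hsub).2
        ⟨y, mem_filter.2 ⟨hyR, hyP⟩, fun hy => ?_⟩)
      rcases hqs y (mem_filter.1 hy).2 with rfl | h
      · exact hzR hyR
      · exact h.2 rfl
  obtain ⟨Q, hQ, hQR⟩ := ih _ hlt _ hsol rfl
  obtain ⟨l, x, hx, hxR⟩ := hcon Q hQ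
  exact hQR l x hx hxR

/-- On a split graph whose non-terminal independent vertices `v 0, v 1, …`
have nested neighborhoods (`N(v j) ⊆ N(v i)` for `i ≤ j`) and number at least `4k + 2`,
the EDP instance is a Yes-instance if and only if it has a solution avoiding all the
vertices `v j` with `j ≥ 4k + 1` (i.e., it is a Yes-instance after deleting them). -/
theorem edp_threshold_deletion {V : Type*} [Fintype V] (G : SimpleGraph V)
    (C I : Finset V) (hsplit : IsSplitPartition G C I)
    {k : ℕ} (X : Fin k → V × V) (hX : ∀ i, (X i).1 ≠ (X i).2)
    {m : ℕ} (v : Fin m → V) (hinj : Function.Injective v)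
    (hrange : ∀ y : V, (∃ i : Fin m, v i = y) ↔ (y ∈ I ∧ ¬ IsTerminal X y))
    (hm : 4 * k + 2 ≤ m)
    (hnested : ∀ i j : Fin m, i ≤ j → ∀ y : V, G.Adj (v j) y → G.Adj (v i) y) :
    EDPYes G X ↔
      ∃ P : WalkFamily G X, IsEDPSolution G X P ∧
        ∀ i : Fin k, ∀ y ∈ (P i).support,
          ¬ ∃ jj : Fin m, 4 * k + 1 ≤ (jj : ℕ) ∧ v jj = y := by
  classical
  refine ⟨fun h => ?_, fun ⟨P, hP, _⟩ => ⟨P, hP⟩⟩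
  let A : Finset V := ({j | (j : ℕ) < 4 * k + 1} : Finset (Fin m)).image v
  let R : Finset V := ({j | 4 * k + 1 ≤ (j : ℕ)} : Finset (Fin m)).image v
  have hA : 4 * k < #A := by
    rw [card_image_of_injective _ hinj, Fin.card_filter_val_lt]
    omega
  have hdisj : Disjoint A R := by
    rw [disjoint_image hinj, disjoint_filter]
    omega
  obtain ⟨P, hP, hPR⟩ := h.exists_solution_avoiding hA hdisj
    (fun y hy => by
      obtain ⟨j, _, hj⟩ := mem_image.1 hy
      exact ((hrange y).1 ⟨j, hj⟩).2)
    (fun z hz y hy x hyx => by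
      obtain ⟨i, hi, rfl⟩ := mem_image.1 hz
      obtain ⟨j, hj, rfl⟩ := mem_image.1 hy
      rw [mem_filter] at hi hj
      exact hnested i j (Fin.le_def.2 (by omega)) x hyx)
  refine ⟨P, hP, fun i y hy ⟨j, hj, hjy⟩ => hPR i y hy ?_⟩
  exact mem_image.2 ⟨j, mem_filter.2 ⟨mem_univ j, hj⟩, hjy⟩
end

section
/- Let G be a finite simple graph and 𝒳 a multiset of k pairs of distinct vertices of G. Let G' be the complete graph on the vertex set V(G), and let 𝒯 be a multiset of terminal pairs containing exactly one pair {u,v} for every pair of distinct non-adjacent vertices u, v of G. Then (G, 𝒳, k) is a Yes-instance of EDP if and only if (G', 𝒳 ∪ 𝒯, k + |𝒯|) is a Yes-instance of EDP. -/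
open SimpleGraph Finset

/-- `(G, X)` is a Yes-instance of EDP iff the terminal pairs can be connected inside pairwise
edge-disjoint subgraphs of `G`. -/
theorem edpYes_iff_exists_disjoint_subgraphs {V ι : Type*} (G : SimpleGraph V) (X : ι → V × V) :
    EDPYes G X ↔ ∃ H : ι → SimpleGraph V, (∀ i, H i ≤ G) ∧
      (∀ i j, i ≠ j → ∀ x y, (H i).Adj x y → ¬ (H j).Adj x y) ∧
      ∀ i, (H i).Reachable (X i).1 (X i).2 := by
  classical
  constructor
  · rintro ⟨P, -, hP⟩
    refine ⟨fun i ↦ fromEdgeSet {e | e ∈ (P i).edges}, fun i x y h ↦ ?_, fun i j hij x y h h' ↦ ?_,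
      fun i ↦ ⟨(P i).transfer _ fun e he ↦ ?_⟩⟩
    · exact (P i).adj_of_mem_edges ((fromEdgeSet_adj _).1 h).1
    · exact hP i j hij _ ((fromEdgeSet_adj _).1 h).1 ((fromEdgeSet_adj _).1 h').1
    · rw [edgeSet_fromEdgeSet]
      exact ⟨he, G.not_isDiag_of_mem_edgeSet ((P i).edges_subset_edgeSet he)⟩
  · rintro ⟨H, hG, hd, hr⟩
    choose p hp using fun i ↦ (hr i).exists_isPath
    refine ⟨fun i ↦ (p i).mapLe (hG i), fun i ↦ (hp i).mapLe (hG i), fun i j hij e ↦ ?_⟩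
    rw [Walk.edges_mapLe_eq_edges, Walk.edges_mapLe_eq_edges]
    induction e with
    | h x y =>
      exact fun h h' ↦ hd i j hij x y ((p i).adj_of_mem_edges h) ((p j).adj_of_mem_edges h')

/-- Reachability transfers between graphs when each edge of the first is bridged in the second. -/
theorem reachable_of_adj_reachable {V : Type*} {G H : SimpleGraph V}
    (h : ∀ x y, G.Adj x y → H.Reachable x y) {u v : V} (huv : G.Reachable u v) :
    H.Reachable u v := by
  obtain ⟨p⟩ := huv
  induction p with
  | nil => exact .rfl
  | cons hadj _ ih => exact (h _ _ hadj).trans ih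

/-- In a family of pairwise edge-disjoint connecting subgraphs, the `j`-th one can be exchanged for
the single edge joining its terminals, altering only a subgraph which contains that edge. -/
theorem exists_reroute_edge {V ι : Type*} (X : ι → V × V) (H : ι → SimpleGraph V)
    (hd : ∀ i j, i ≠ j → ∀ x y, (H i).Adj x y → ¬ (H j).Adj x y)
    (hr : ∀ i, (H i).Reachable (X i).1 (X i).2) (j : ι) (hj : (X j).1 ≠ (X j).2) :
    ∃ H' : ι → SimpleGraph V,
      (∀ i j, i ≠ j → ∀ x y, (H' i).Adj x y → ¬ (H' j).Adj x y) ∧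
      (∀ i, (H' i).Reachable (X i).1 (X i).2) ∧ H' j = edge (X j).1 (X j).2 ∧
      ∀ i, i ≠ j → ¬ (H i).Adj (X j).1 (X j).2 → H' i = H i := by
  classical
  let H' : ι → SimpleGraph V := fun i ↦
    if i = j then edge (X j).1 (X j).2
    else if (H i).Adj (X j).1 (X j).2 then (H i ⊔ H j) \ edge (X j).1 (X j).2
    else H i
  refine ⟨H', fun i i' hii' x y h h' ↦ ?_, fun i ↦ ?_, by simp [H'], fun i hi hij ↦ by simp [H', *]⟩
  · have := hd i i' hii' x y
    have := hd i j
    have := hd i' j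
    have := hd i i' hii' (X j).1 (X j).2
    have := (H i).adj_comm x y
    have := (H i').adj_comm x y
    simp only [H'] at h h'
    split_ifs at h h' <;> grind [sdiff_adj]
  · by_cases hi : i = j
    · subst hi
      exact Adj.reachable (by simp [H', edge_adj, hj])
    by_cases ha : (H i).Adj (X j).1 (X j).2
    · have hH : H' i = (H i ⊔ H j) \ edge (X j).1 (X j).2 := by simp [H', hi, ha]
      have hle : H j ≤ H' i := by
        intro x y h
        rw [hH, sdiff_adj, sup_adj, edge_adj]
        refine ⟨.inr h, fun h' ↦ hd i j hi x y ?_ h⟩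
        rcases h'.1 with ⟨rfl, rfl⟩ | ⟨rfl, rfl⟩
        exacts [ha, ha.symm]
      have hb := (hr j).mono hle
      refine reachable_of_adj_reachable (fun x y h ↦ ?_) (hr i)
      by_cases he : (edge (X j).1 (X j).2).Adj x y
      · rcases ((edge_adj ..).1 he).1 with ⟨rfl, rfl⟩ | ⟨rfl, rfl⟩
        exacts [hb, hb.symm]
      · exact Adj.reachable (by rw [hH]; exact ⟨.inl h, he⟩)
    · simpa [H', hi, ha] using hr i

/-- Pairwise edge-disjoint connecting subgraphs can be chosen so that those indexed by `s` are
single edges, if the terminal pairs indexed by `s` are distinct as unordered pairs. -/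
theorem exists_disjoint_subgraphs_eq_edge {V ι : Type*} (X : ι → V × V) (s : Finset ι)
    (hs : ∀ i ∈ s, (X i).1 ≠ (X i).2)
    (hinj : ∀ i ∈ s, ∀ j ∈ s, s((X i).1, (X i).2) = s((X j).1, (X j).2) → i = j)
    (hH : ∃ H : ι → SimpleGraph V,
      (∀ i j, i ≠ j → ∀ x y, (H i).Adj x y → ¬ (H j).Adj x y) ∧
      ∀ i, (H i).Reachable (X i).1 (X i).2) :
    ∃ H : ι → SimpleGraph V,
      (∀ i j, i ≠ j → ∀ x y, (H i).Adj x y → ¬ (H j).Adj x y) ∧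
      (∀ i, (H i).Reachable (X i).1 (X i).2) ∧ ∀ i ∈ s, H i = edge (X i).1 (X i).2 := by
  classical
  induction s using Finset.induction_on with
  | empty => simpa using hH
  | insert j s hjs ih =>
    obtain ⟨H, hd, hr, he⟩ := ih (fun i hi ↦ hs i (mem_insert_of_mem hi))
      fun i hi i' hi' ↦ hinj i (mem_insert_of_mem hi) i' (mem_insert_of_mem hi')
    obtain ⟨H', hd', hr', hj, hH'⟩ := exists_reroute_edge X H hd hr j (hs j (mem_insert_self j s))
    refine ⟨H', hd', hr', fun i hi ↦ ?_⟩
    obtain rfl | hi' := mem_insert.1 hi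
    · exact hj
    · have hij : i ≠ j := fun h ↦ hjs (h ▸ hi')
      rw [hH' i hij, he i hi']
      rw [he i hi', edge_adj]
      intro h
      refine hij (hinj i hi j (mem_insert_self j s) ?_)
      rw [Sym2.eq_iff]
      grind

/-- An EDP instance `(G, X, k)` is a Yes-instance if and only if the
instance on the complete graph on `V(G)`, obtained by adding one terminal pair for every
unordered pair of distinct non-adjacent vertices of `G`, is a Yes-instance. -/
theorem edp_completion_equiv {V : Type*} (G : SimpleGraph V)
    {k m : ℕ} (X : Fin k → V × V) (hX : ∀ i, (X i).1 ≠ (X i).2)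
    (T : Fin m → V × V)
    (hT : ∀ j : Fin m, (T j).1 ≠ (T j).2 ∧ ¬ G.Adj (T j).1 (T j).2)
    (hTall : ∀ u w : V, u ≠ w → ¬ G.Adj u w →
      ∃! j : Fin m, T j = (u, w) ∨ T j = (w, u)) :
    EDPYes G X ↔ EDPYes (⊤ : SimpleGraph V) (Fin.append X T) := by
  have hinj : ∀ i j, s((T i).1, (T i).2) = s((T j).1, (T j).2) → i = j := by
    intro i j h
    refine (hTall _ _ (hT j).1 (hT j).2).unique ?_ (.inl rfl)
    simpa [Prod.ext_iff] using Sym2.eq_iff.1 h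
  rw [edpYes_iff_exists_disjoint_subgraphs, edpYes_iff_exists_disjoint_subgraphs]
  constructor
  · rintro ⟨H, hG, hd, hr⟩
    have hT' : ∀ j x y, (edge (T j).1 (T j).2).Adj x y → ¬ G.Adj x y := by
      intro j x y h h'
      rcases ((edge_adj ..).1 h).1 with ⟨rfl, rfl⟩ | ⟨rfl, rfl⟩
      exacts [(hT j).2 h', (hT j).2 h'.symm]
    refine ⟨Fin.append H fun j ↦ edge (T j).1 (T j).2, fun _ ↦ le_top, fun i j hij x y ↦ ?_,
      fun i ↦ ?_⟩
    · induction i using Fin.addCases <;> induction j using Fin.addCases <;>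
        simp only [Fin.append_left, Fin.append_right]
      · exact hd _ _ (fun h ↦ hij (by rw [h])) x y
      · exact fun h h' ↦ hT' _ x y h' (hG _ h)
      · exact fun h h' ↦ hT' _ x y h (hG _ h')
      · intro h h'
        refine hij (congrArg _ (hinj _ _ ?_))
        rw [Sym2.eq_iff]
        rw [edge_adj] at h h'
        grind
    · induction i using Fin.addCases with
      | left i => simpa using hr i
      | right j =>
        simp only [Fin.append_right]
        exact Adj.reachable (by simp [edge_adj, (hT j).1])
  · rintro ⟨H₀, -, hd₀, hr₀⟩
    obtain ⟨H, hd, hr, he⟩ := exists_disjoint_subgraphs_eq_edge (Fin.append X T)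
      (Finset.univ.map (Fin.natAddEmb k)) (by simpa using fun j ↦ (hT j).1)
      (by simpa using fun i j ↦ by simpa using hinj i j) ⟨H₀, hd₀, hr₀⟩
    refine ⟨fun i ↦ H (Fin.castAdd m i), fun i x y h ↦ ?_,
      fun i j hij ↦ hd _ _ fun h ↦ hij (Fin.castAdd_injective _ _ h),
      fun i ↦ by simpa using hr (Fin.castAdd m i)⟩
    by_contra hG
    obtain ⟨j, hj, -⟩ := hTall x y h.ne hG
    refine hd (Fin.castAdd m i) (Fin.natAdd k j) (by simp [Fin.ext_iff]; omega) x y h ?_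
    rw [he _ (by simp), Fin.append_right, edge_adj]
    rcases hj with hj | hj <;> simp [hj, h.ne]
end
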